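/- Let (q_n)_{n≥1} be a sequence of reals with 0 < q_n < 1, assume that for every y ∈ (0,1) the series Σ_{n=3}^∞ sup_{0≤x≤1} D_n^{q_n}((t−x)²)(x) · yⁿ converges, and define φ(y) = ((1−y) · sup_{0≤x≤1} Σ_{n=3}^∞ D_n^{q_n}((t−x)²)(x) yⁿ)^{1/2}; assume φ(y) > 0 for all y ∈ (0,1). Let μ : (0,1) → (0,∞) and let f ∈ C[0,1]. If ω(f, φ(y))/μ(y) → 0 as y → 1⁻, then (1−y) · sup_{0≤x≤1} |Σ_{n=3}^∞ (D_n^{q_n}(f)(x) − f(x)) yⁿ| / μ(y) → 0 as y → 1⁻. -/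

import Mathlib

open Filter Topology

/-- The `q`-integer `[n]_q = 1 + q + ⋯ + q^{n-1}`. -/
noncomputable def qInt (q : ℝ) (n : ℕ) : ℝ := ∑ k ∈ Finset.range n, q ^ k

/-- The `q`-factorial `[n]_q!`. -/
noncomputable def qFact (q : ℝ) (n : ℕ) : ℝ := ∏ k ∈ Finset.range n, qInt q (k + 1)

/-- The `q`-binomial coefficient `[m choose r]_q`. -/
noncomputable def qBinom (q : ℝ) (m r : ℕ) : ℝ := qFact q m / (qFact q r * qFact q (m - r))

/-- The Jackson `q`-integral of `g` over `[0,1]`. -/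
noncomputable def qIntegral (q : ℝ) (g : ℝ → ℝ) : ℝ := (1 - q) * ∑' m : ℕ, q ^ m * g (q ^ m)

/-- The `q`-shifted factorial `(t;q)_n`. -/
noncomputable def qShift (q t : ℝ) (n : ℕ) : ℝ := ∏ j ∈ Finset.range n, (1 - t * q ^ j)

/-- The `q`-beta function `B_q(m,n)`. -/
noncomputable def qBeta (q : ℝ) (m n : ℕ) : ℝ :=
  qIntegral q (fun t => t ^ (m - 1) * qShift q (q * t) (n - 1))

/-- The weight `m_{n,k,q}(x) = (x;q)_{n+1} [n+k choose k]_q x^k`. -/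
noncomputable def mWeight (q : ℝ) (n k : ℕ) (x : ℝ) : ℝ :=
  qShift q x (n + 1) * qBinom q (n + k) k * x ^ k

/-- The `q`-MKZ–Durrmeyer operator. -/
noncomputable def Durr (q : ℝ) (n : ℕ) (f : ℝ → ℝ) (x : ℝ) : ℝ :=
  if x = 1 then f 1
  else mWeight q n 0 x * f 0 +
    ∑' k : ℕ, mWeight q n (k + 1) x * (1 / qBeta q n (k + 1)) *
      qIntegral q (fun t => t ^ k * qShift q (q * t) (n - 1) * f t)

/-- The modulus of continuity of `f` on `[0,1]`. -/
noncomputable def modulus (f : ℝ → ℝ) (δ : ℝ) : ℝ :=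
  sSup {z : ℝ | ∃ x y : ℝ, x ∈ Set.Icc (0 : ℝ) 1 ∧ y ∈ Set.Icc (0 : ℝ) 1 ∧
    |x - y| ≤ δ ∧ z = |f x - f y|}

/-- `φ(y) = ((1-y) · sup_x Σ_{n≥3} D_n^{q_n}((t-x)²)(x) yⁿ)^{1/2}`. -/
noncomputable def phiD (q : ℕ → ℝ) (y : ℝ) : ℝ :=
  Real.sqrt ((1 - y) * ⨆ x : Set.Icc (0 : ℝ) 1,
    ∑' n : ℕ, Durr (q (n + 3)) (n + 3) (fun t => (t - (x : ℝ)) ^ 2) x * y ^ (n + 3))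

/-- Boundedness of a function on `[0,1]`. -/
def BddOnUnit (f : ℝ → ℝ) : Prop := ∃ M, ∀ t ∈ Set.Icc (0 : ℝ) 1, |f t| ≤ M

/-- A monotone, normalized, affine functional on the functions bounded on `[0,1]`. -/
structure IsMean (L : (ℝ → ℝ) → ℝ) : Prop where
  mono : ∀ f g, BddOnUnit f → BddOnUnit g → (∀ t ∈ Set.Icc (0 : ℝ) 1, f t ≤ g t) → L f ≤ L g
  affine : ∀ (a b : ℝ) g, BddOnUnit g → L (fun t => a + b * g t) = a + b * L g

theorem BddOnUnit.const (a : ℝ) : BddOnUnit (fun _ => a) := ⟨|a|, fun _ _ => le_rfl⟩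

theorem BddOnUnit.affine {g : ℝ → ℝ} (hg : BddOnUnit g) (a b : ℝ) :
    BddOnUnit (fun t => a + b * g t) := by
  obtain ⟨M, hM⟩ := hg
  refine ⟨|a| + |b| * M, fun t ht => (abs_add_le _ _).trans ?_⟩
  rw [abs_mul]
  gcongr
  exact hM t ht

theorem bddOnUnit_sq_sub {x : ℝ} (hx : x ∈ Set.Icc (0 : ℝ) 1) :
    BddOnUnit (fun t => (t - x) ^ 2) := by
  refine ⟨1, fun t ht => ?_⟩
  rw [abs_of_nonneg (sq_nonneg _)]
  have h1 : |t - x| ≤ 1 := abs_le.2 ⟨by linarith [ht.1, hx.2], by linarith [ht.2, hx.1]⟩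
  exact (sq_le_one_iff_abs_le_one _).2 h1

namespace IsMean

theorem apply_const {L : (ℝ → ℝ) → ℝ} (hL : IsMean L) (a : ℝ) : L (fun _ => a) = a := by
  simpa using hL.affine a 0 (fun _ => 0) (BddOnUnit.const 0)

theorem abs_le {L : (ℝ → ℝ) → ℝ} (hL : IsMean L) {f : ℝ → ℝ} {M : ℝ}
    (hM : ∀ t ∈ Set.Icc (0 : ℝ) 1, |f t| ≤ M) : |L f| ≤ M := by
  refine _root_.abs_le.2 ⟨?_, ?_⟩
  · rw [← hL.apply_const (-M)]
    exact hL.mono _ _ (BddOnUnit.const _) ⟨M, hM⟩ fun t ht => (_root_.abs_le.1 (hM t ht)).1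
  · rw [← hL.apply_const M]
    exact hL.mono _ _ ⟨M, hM⟩ (BddOnUnit.const _) fun t ht => (_root_.abs_le.1 (hM t ht)).2

theorem of_point {x : ℝ} (hx : x ∈ Set.Icc (0 : ℝ) 1) : IsMean (fun f => f x) where
  mono _ _ _ _ h := h x hx
  affine _ _ _ _ := rfl

/-- A countable weighted average of means is a mean. -/
theorem tsum {w : ℕ → ℝ} (hw : ∀ k, 0 ≤ w k) (hw1 : HasSum w 1)
    {L : ℕ → (ℝ → ℝ) → ℝ} (hL : ∀ k, IsMean (L k)) :
    (∀ f, BddOnUnit f → Summable (fun k => w k * L k f)) ∧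
      IsMean (fun f => ∑' k, w k * L k f) := by
  have hs : ∀ f, BddOnUnit f → Summable (fun k => w k * L k f) := by
    rintro f ⟨M, hM⟩
    refine Summable.of_norm_bounded (hw1.summable.mul_right M) fun k => ?_
    rw [Real.norm_eq_abs, abs_mul, abs_of_nonneg (hw k)]
    exact mul_le_mul_of_nonneg_left ((hL k).abs_le hM) (hw k)
  refine ⟨hs, ⟨fun f g hf hg h => ?_, fun a b g hg => ?_⟩⟩
  · exact (hs f hf).tsum_le_tsum
      (fun k => mul_le_mul_of_nonneg_left ((hL k).mono f g hf hg h) (hw k)) (hs g hg)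
  · have h := (hw1.mul_left a).add ((hs g hg).hasSum.mul_left b)
    rw [mul_one] at h
    rw [← h.tsum_eq]
    refine tsum_congr fun k => ?_
    rw [(hL k).affine a b g hg]
    ring

end IsMean

theorem BddOnUnit.of_continuousOn {f : ℝ → ℝ} (hf : ContinuousOn f (Set.Icc 0 1)) :
    BddOnUnit f := by
  obtain ⟨M, hM⟩ := isCompact_Icc.exists_bound_of_continuousOn hf
  exact ⟨M, hM⟩

theorem abs_sub_le_modulus {f : ℝ → ℝ} (hf : BddOnUnit f) {δ x t : ℝ}
    (hx : x ∈ Set.Icc (0 : ℝ) 1) (ht : t ∈ Set.Icc (0 : ℝ) 1) (h : |x - t| ≤ δ) :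
    |f x - f t| ≤ modulus f δ := by
  obtain ⟨M, hM⟩ := hf
  refine le_csSup ⟨M + M, ?_⟩ ⟨x, t, hx, ht, h, rfl⟩
  rintro _ ⟨u, v, hu, hv, -, rfl⟩
  exact (abs_sub _ _).trans (add_le_add (hM u hu) (hM v hv))

theorem modulus_nonneg (f : ℝ → ℝ) (δ : ℝ) : 0 ≤ modulus f δ := by
  refine Real.sSup_nonneg ?_
  rintro _ ⟨u, v, -, -, -, rfl⟩
  exact abs_nonneg _

theorem abs_sub_le_nat_mul_modulus {f : ℝ → ℝ} (hf : BddOnUnit f) {δ : ℝ} (N : ℕ) {x t : ℝ}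
    (hx : x ∈ Set.Icc (0 : ℝ) 1) (ht : t ∈ Set.Icc (0 : ℝ) 1) (h : |x - t| ≤ N * δ) :
    |f x - f t| ≤ N * modulus f δ := by
  induction N generalizing x with
  | zero =>
    have : x = t := by
      rw [Nat.cast_zero, zero_mul] at h
      exact sub_eq_zero.1 (abs_nonpos_iff.1 h)
    simp [this]
  | succ N ih =>
    have hN : (0 : ℝ) < N + 1 := by positivity
    push_cast at h ⊢
    have hδ : |x - t| / (N + 1) ≤ δ := by
      rw [div_le_iff₀ hN]; linarith
    have hz : (N / (N + 1) : ℝ) * x + (1 / (N + 1)) * t ∈ Set.Icc (0 : ℝ) 1 :=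
      (convex_Icc (0 : ℝ) 1) hx ht (div_nonneg N.cast_nonneg hN.le) (one_div_nonneg.2 hN.le)
        (by field_simp)
    set z := (N / (N + 1) : ℝ) * x + (1 / (N + 1)) * t with hzdef
    have e1 : x - z = (x - t) / (N + 1) := by rw [hzdef]; field_simp; ring
    have e2 : z - t = N * ((x - t) / (N + 1)) := by rw [hzdef]; field_simp; ring
    have h1 : |x - z| ≤ δ := by
      rw [e1, abs_div, abs_of_pos hN]; exact hδ
    have h2 : |z - t| ≤ N * δ := by
      rw [e2, abs_mul, abs_div, abs_of_pos hN, Nat.abs_cast]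
      gcongr
    have h3 := abs_sub_le_modulus hf hx hz h1
    have h4 := ih hz h2
    have h5 := abs_sub_le (f x) (f z) (f t)
    linarith

theorem abs_sub_le_modulus_mul {f : ℝ → ℝ} (hf : BddOnUnit f) {δ : ℝ} (hδ : 0 < δ) {x t : ℝ}
    (hx : x ∈ Set.Icc (0 : ℝ) 1) (ht : t ∈ Set.Icc (0 : ℝ) 1) :
    |f t - f x| ≤ modulus f δ * (1 + (t - x) ^ 2 / δ ^ 2) := by
  have hω := modulus_nonneg f δ
  rcases le_or_gt |t - x| δ with h | h
  · refine (abs_sub_le_modulus hf ht hx h).trans (le_mul_of_one_le_right hω ?_)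
    have : 0 ≤ (t - x) ^ 2 / δ ^ 2 := by positivity
    linarith
  · have hl : 1 ≤ |t - x| / δ := (one_le_div hδ).2 h.le
    have hfl := Nat.lt_floor_add_one (|t - x| / δ)
    have hfl' := Nat.floor_le (zero_le_one.trans hl)
    have h1 : |t - x| ≤ ((⌊|t - x| / δ⌋₊ + 1 : ℕ) : ℝ) * δ := by
      push_cast
      exact ((div_lt_iff₀ hδ).1 hfl).le
    refine (abs_sub_le_nat_mul_modulus hf _ ht hx h1).trans ?_
    rw [mul_comm]
    refine mul_le_mul_of_nonneg_left ?_ hω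
    have h2 : (t - x) ^ 2 / δ ^ 2 = (|t - x| / δ) ^ 2 := by rw [div_pow, sq_abs]
    rw [h2]
    push_cast
    nlinarith

theorem IsMean.abs_sub_le {L : (ℝ → ℝ) → ℝ} (hL : IsMean L) {f : ℝ → ℝ} (hf : BddOnUnit f)
    {δ : ℝ} (hδ : 0 < δ) {x : ℝ} (hx : x ∈ Set.Icc (0 : ℝ) 1) :
    |L f - f x| ≤ modulus f δ * (1 + L (fun t => (t - x) ^ 2) / δ ^ 2) := by
  have hg := bddOnUnit_sq_sub hx
  have key := fun t ht => _root_.abs_le.1 (abs_sub_le_modulus_mul hf hδ hx (t := t) ht)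
  have hu := hL.mono f _ hf (hg.affine (f x + modulus f δ) (modulus f δ / δ ^ 2))
    (fun t ht => by have := (key t ht).2; ring_nf at this ⊢; linarith)
  have hl := hL.mono _ f (hg.affine (f x - modulus f δ) (-(modulus f δ / δ ^ 2))) hf
    (fun t ht => by have := (key t ht).1; ring_nf at this ⊢; linarith)
  rw [hL.affine _ _ _ hg] at hu hl
  have e : modulus f δ * (1 + L (fun t => (t - x) ^ 2) / δ ^ 2) =
    modulus f δ + modulus f δ / δ ^ 2 * L (fun t => (t - x) ^ 2) := by ring
  rw [e]
  exact _root_.abs_le.2 ⟨by linarith, by linarith⟩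

section QCalculus

variable {q : ℝ}

theorem one_sub_mul_qInt (q : ℝ) (n : ℕ) : (1 - q) * qInt q n = 1 - q ^ n :=
  mul_neg_geom_sum q n

theorem qInt_succ_pos (hq : 0 < q) (n : ℕ) : 0 < qInt q (n + 1) :=
  Finset.sum_pos (fun _ _ => pow_pos hq _) (by simp)

theorem qInt_add (q : ℝ) (m n : ℕ) : qInt q (m + n) = qInt q m + q ^ m * qInt q n := by
  simp [qInt, Finset.sum_range_add, pow_add, Finset.mul_sum]

theorem qFact_pos (hq : 0 < q) (n : ℕ) : 0 < qFact q n :=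
  Finset.prod_pos fun _ _ => qInt_succ_pos hq _

theorem qFact_succ (q : ℝ) (n : ℕ) : qFact q (n + 1) = qFact q n * qInt q (n + 1) :=
  Finset.prod_range_succ _ _

theorem qFact_zero (q : ℝ) : qFact q 0 = 1 := Finset.prod_range_zero _

theorem qShift_succ (q t : ℝ) (n : ℕ) : qShift q t (n + 1) = qShift q t n * (1 - t * q ^ n) :=
  Finset.prod_range_succ _ _

theorem qShift_zero (q t : ℝ) : qShift q t 0 = 1 := Finset.prod_range_zero _

theorem qShift_pos (hq : 0 < q) (hq1 : q < 1) {t : ℝ} (ht0 : 0 ≤ t) (ht : t < 1) (n : ℕ) :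
    0 < qShift q t n := by
  refine Finset.prod_pos fun j _ => ?_
  have : t * q ^ j ≤ t * 1 := mul_le_mul_of_nonneg_left (pow_le_one₀ hq.le hq1.le) ht0
  linarith

theorem qFact_add_le (hq : 0 < q) (hq1 : q < 1) (k n : ℕ) :
    qFact q (n + k) ≤ qFact q k * (1 / (1 - q)) ^ n := by
  have h1 : 0 < 1 - q := sub_pos.2 hq1
  induction n with
  | zero => simp
  | succ n ih =>
    rw [show n + 1 + k = n + k + 1 by ring, qFact_succ, pow_succ, ← mul_assoc]
    refine mul_le_mul ih ?_ (qInt_succ_pos hq _).le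
      (mul_nonneg (qFact_pos hq _).le (by positivity))
    rw [le_div_iff₀ h1, mul_comm, one_sub_mul_qInt]
    linarith [pow_pos hq (n + k + 1)]

theorem qBinom_nonneg (hq : 0 < q) (m r : ℕ) : 0 ≤ qBinom q m r :=
  div_nonneg (qFact_pos hq _).le (mul_pos (qFact_pos hq _) (qFact_pos hq _)).le

theorem qBinom_succ_succ (hq : 0 < q) (n k : ℕ) :
    qBinom q (n + 1 + (k + 1)) (k + 1) =
      qBinom q (n + (k + 1)) (k + 1) + q ^ (n + 1) * qBinom q (n + 1 + k) k := by
  simp only [qBinom, Nat.add_sub_cancel]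
  have e := qInt_add q (n + 1) (k + 1)
  rw [show n + 1 + (k + 1) = n + k + 1 + 1 by ring, show n + (k + 1) = n + k + 1 by ring,
    show n + 1 + k = n + k + 1 by ring] at *
  rw [qFact_succ q (n + k + 1), e, qFact_succ q n, qFact_succ q k]
  have := (qFact_pos hq n).ne'
  have := (qFact_pos hq k).ne'
  have := (qInt_succ_pos hq n).ne'
  have := (qInt_succ_pos hq k).ne'
  field_simp

theorem summable_qBinom_mul_pow (hq : 0 < q) (hq1 : q < 1) {x : ℝ} (hx0 : 0 ≤ x) (hx : x < 1)
    (n : ℕ) : Summable (fun k => qBinom q (n + k) k * x ^ k) := by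
  refine Summable.of_nonneg_of_le
    (fun k => mul_nonneg (qBinom_nonneg hq _ _) (pow_nonneg hx0 _)) (fun k => ?_)
    ((summable_geometric_of_lt_one hx0 hx).mul_left ((1 / (1 - q)) ^ n / qFact q n))
  refine mul_le_mul_of_nonneg_right ?_ (pow_nonneg hx0 _)
  rw [qBinom, Nat.add_sub_cancel, div_le_div_iff₀
    (mul_pos (qFact_pos hq _) (qFact_pos hq _)) (qFact_pos hq _)]
  nlinarith [mul_le_mul_of_nonneg_right (qFact_add_le hq hq1 k n) (qFact_pos hq n).le]

/-- The `q`-binomial series. -/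
theorem hasSum_qBinom_mul_pow (hq : 0 < q) (hq1 : q < 1) {x : ℝ} (hx0 : 0 ≤ x) (hx : x < 1)
    (n : ℕ) : HasSum (fun k => qBinom q (n + k) k * x ^ k) (1 / qShift q x (n + 1)) := by
  induction n with
  | zero =>
    have h (k : ℕ) : qBinom q k k = 1 := by
      simp [qBinom, qFact_zero, (qFact_pos hq k).ne']
    simpa only [h, qShift_succ, qShift_zero, zero_add, one_mul, pow_zero, mul_one, one_div] using hasSum_geometric_of_lt_one hx0 hx
  | succ n ih =>
    have hs := summable_qBinom_mul_pow hq hq1 hx0 hx (n + 1)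
    have h0 (m : ℕ) : qBinom q (m + 0) 0 = 1 := by
      simp [qBinom, qFact_zero, (qFact_pos hq m).ne']
    have key : ∑' k, qBinom q (n + 1 + k) k * x ^ k =
        1 / qShift q x (n + 1) + q ^ (n + 1) * x * ∑' k, qBinom q (n + 1 + k) k * x ^ k := by
      conv_lhs => rw [hs.tsum_eq_zero_add]
      rw [← ih.tsum_eq, ih.summable.tsum_eq_zero_add, h0, h0, add_assoc, ← tsum_mul_left,
        ← ((summable_nat_add_iff 1).2 ih.summable).tsum_add (hs.mul_left _)]
      congr 1
      refine tsum_congr fun k => ?_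
      rw [qBinom_succ_succ hq]
      ring
    have h1 := (qShift_pos hq hq1 hx0 hx (n + 1)).ne'
    have h2 := qShift_pos hq hq1 hx0 hx (n + 1 + 1)
    have h3 : qShift q x (n + 1 + 1) ≠ 0 := h2.ne'
    convert hs.hasSum using 1
    rw [qShift_succ] at h3 ⊢
    have h4 := right_ne_zero_of_mul h3
    rw [div_eq_iff h3]
    field_simp at key
    linear_combination (-1 : ℝ) * key

theorem hasSum_qBeta (hq : 0 < q) (hq1 : q < 1) (n a : ℕ) :
    HasSum (fun m : ℕ => (1 - q) * (q ^ m * ((q ^ m) ^ a * qShift q (q * q ^ m) n)))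
      (qFact q a * qFact q n / qFact q (a + n + 1)) := by
  induction n generalizing a with
  | zero =>
    have ha : q ^ (a + 1) < 1 := pow_lt_one₀ hq.le hq1 (by simp)
    have h := (hasSum_geometric_of_lt_one (pow_nonneg hq.le (a + 1)) ha).mul_left (1 - q)
    have e : qFact q a * qFact q 0 / qFact q (a + 0 + 1) = (1 - q) * (1 - q ^ (a + 1))⁻¹ := by
      rw [add_zero, qFact_succ, qFact_zero, ← one_sub_mul_qInt]
      have := (qFact_pos hq a).ne'
      have := (qInt_succ_pos hq a).ne'
      have : 1 - q ≠ 0 := (sub_pos.2 hq1).ne'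
      field_simp
    rw [e]
    refine (congrArg (fun g => HasSum g _) (funext fun m => ?_)).mpr h
    rw [qShift_zero]
    ring
  | succ n ih =>
    have h := (ih a).sub ((ih (a + 1)).mul_left (q ^ (n + 1)))
    have e' : qFact q a * qFact q (n + 1) / qFact q (a + (n + 1) + 1) =
        qFact q a * qFact q n / qFact q (a + n + 1) -
          q ^ (n + 1) * (qFact q (a + 1) * qFact q n / qFact q (a + 1 + n + 1)) := by
      have e := qInt_add q (n + 1) (a + 1)
      rw [show n + 1 + (a + 1) = a + n + 1 + 1 by ring] at e
      rw [show a + (n + 1) + 1 = a + n + 1 + 1 by ring,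
        show a + 1 + n + 1 = a + n + 1 + 1 by ring, qFact_succ q (a + n + 1), qFact_succ q n,
        qFact_succ q a]
      have h1 := (qFact_pos hq (a + n + 1)).ne'
      have h2 := (qInt_succ_pos hq (a + n + 1)).ne'
      rw [e] at h2 ⊢
      field_simp
      ring
    rw [e']
    refine (congrArg (fun g => HasSum g _) (funext fun m => ?_)).mpr h
    rw [qShift_succ]
    ring

theorem qBeta_eq (hq : 0 < q) (hq1 : q < 1) (m n : ℕ) :
    qBeta q (m + 1) (n + 1) = qFact q m * qFact q n / qFact q (m + n + 1) := by
  rw [← (hasSum_qBeta hq hq1 n m).tsum_eq, tsum_mul_left]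
  rfl

theorem isMean_qIntegral (hq : 0 < q) (hq1 : q < 1) (n k : ℕ) :
    IsMean (fun f => (1 / qBeta q (n + 1) (k + 1)) *
      qIntegral q (fun t => t ^ k * qShift q (q * t) n * f t)) := by
  have hm (m : ℕ) : q ^ m ∈ Set.Icc (0 : ℝ) 1 := ⟨pow_nonneg hq.le _, pow_le_one₀ hq.le hq1.le⟩
  have hB : qBeta q (n + 1) (k + 1) = qFact q k * qFact q n / qFact q (k + n + 1) := by
    rw [qBeta_eq hq hq1, mul_comm, add_comm n k]
  have hB0 : 0 < qBeta q (n + 1) (k + 1) := by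
    rw [hB]
    exact div_pos (mul_pos (qFact_pos hq _) (qFact_pos hq _)) (qFact_pos hq _)
  have hw1 := (hasSum_qBeta hq hq1 n k).mul_left (1 / qBeta q (n + 1) (k + 1))
  rw [← hB, one_div_mul_cancel hB0.ne'] at hw1
  have hw : ∀ m : ℕ, 0 ≤ 1 / qBeta q (n + 1) (k + 1) *
      ((1 - q) * (q ^ m * ((q ^ m) ^ k * qShift q (q * q ^ m) n))) := by
    intro m
    have h1 : q * q ^ m < 1 := by
      rw [← pow_succ']
      exact pow_lt_one₀ hq.le hq1 (by simp)
    have h2 := qShift_pos hq hq1 (by positivity) h1 n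
    have h3 : 0 < 1 - q := sub_pos.2 hq1
    positivity
  convert (IsMean.tsum hw hw1 (fun m => IsMean.of_point (hm m))).2 using 2 with f
  rw [qIntegral, ← tsum_mul_left, ← tsum_mul_left]
  refine tsum_congr fun m => ?_
  ring

theorem isMean_Durr (hq : 0 < q) (hq1 : q < 1) (n : ℕ) {x : ℝ} (hx : x ∈ Set.Icc (0 : ℝ) 1) :
    IsMean (fun f => Durr q (n + 1) f x) := by
  by_cases h1 : x = 1
  · simpa [Durr, h1] using IsMean.of_point (x := 1) (by simp)
  have hx1 : x < 1 := lt_of_le_of_ne hx.2 h1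
  have hS := qShift_pos hq hq1 hx.1 hx1 (n + 1 + 1)
  have hw : ∀ k, 0 ≤ mWeight q (n + 1) k x := fun k =>
    mul_nonneg (mul_nonneg hS.le (qBinom_nonneg hq _ _)) (pow_nonneg hx.1 _)
  have hw1 : HasSum (fun k => mWeight q (n + 1) k x) 1 := by
    have h := (hasSum_qBinom_mul_pow hq hq1 hx.1 hx1 (n + 1)).mul_left (qShift q x (n + 1 + 1))
    rw [mul_one_div_cancel hS.ne'] at h
    simpa only [mWeight, mul_assoc] using h
  let L : ℕ → (ℝ → ℝ) → ℝ := fun k => k.casesOn (fun f => f 0) (fun k f =>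
    (1 / qBeta q (n + 1) (k + 1)) * qIntegral q (fun t => t ^ k * qShift q (q * t) n * f t))
  have hL : ∀ k, IsMean (L k) := by
    rintro (_ | k)
    · exact IsMean.of_point (by simp)
    · exact isMean_qIntegral hq hq1 n k
  obtain ⟨hs, hM⟩ := IsMean.tsum hw hw1 hL
  have e : ∀ f, BddOnUnit f → Durr q (n + 1) f x = ∑' k, mWeight q (n + 1) k x * L k f := by
    intro f hf
    rw [(hs f hf).tsum_eq_zero_add, Durr, if_neg h1]
    congr 1
    refine tsum_congr fun k => ?_
    rw [mul_assoc]
    rfl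
  refine ⟨fun f g hf hg h => ?_, fun a b g hg => ?_⟩
  · rw [e f hf, e g hg]
    exact hM.mono f g hf hg h
  · rw [e _ (hg.affine a b), e g hg]
    exact hM.affine a b g hg

end QCalculus

/-- Quantitative estimate for the Abel means of a sequence of positive normalized operators. -/
theorem abel_abs_tsum_le {L : ℕ → (ℝ → ℝ) → ℝ → ℝ}
    (hL : ∀ n, ∀ x ∈ Set.Icc (0 : ℝ) 1, IsMean (fun f => L n f x)) {f : ℝ → ℝ}
    (hf : BddOnUnit f) {y δ : ℝ} (hy : y ∈ Set.Ioo (0 : ℝ) 1) (hδ : 0 < δ)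
    (hδy : δ ^ 2 = (1 - y) * ⨆ x : Set.Icc (0 : ℝ) 1,
      ∑' n : ℕ, L n (fun t => (t - (x : ℝ)) ^ 2) x * y ^ (n + 3)) (x : Set.Icc (0 : ℝ) 1) :
    (1 - y) * |∑' n : ℕ, (L n f x - f x) * y ^ (n + 3)| ≤ 2 * modulus f δ := by
  obtain ⟨hy0, hy1⟩ := hy
  have hy1' : 0 < 1 - y := sub_pos.2 hy1
  have hgeo : HasSum (fun n : ℕ => y ^ (n + 3)) (y ^ 3 * (1 - y)⁻¹) := by
    simpa only [pow_add, mul_comm] using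
      (hasSum_geometric_of_lt_one hy0.le hy1).mul_left (y ^ 3)
  have hD (z : Set.Icc (0 : ℝ) 1) (n : ℕ) :
      0 ≤ L n (fun t => (t - (z : ℝ)) ^ 2) z ∧ L n (fun t => (t - (z : ℝ)) ^ 2) z ≤ 1 := by
    have hb := bddOnUnit_sq_sub z.2
    have hm := hL n z z.2
    refine ⟨?_, ?_⟩
    · exact (hm.apply_const 0).ge.trans
        (hm.mono _ _ (BddOnUnit.const 0) hb fun t _ => sq_nonneg _)
    · refine (le_abs_self _).trans (hm.abs_le fun t ht => ?_)
      rw [abs_of_nonneg (sq_nonneg _), sq_le_one_iff_abs_le_one]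
      exact abs_le.2 ⟨by linarith [ht.1, z.2.2], by linarith [ht.2, z.2.1]⟩
  have hle (z : Set.Icc (0 : ℝ) 1) (n : ℕ) :
      L n (fun t => (t - (z : ℝ)) ^ 2) z * y ^ (n + 3) ≤ y ^ (n + 3) :=
    mul_le_of_le_one_left (by positivity) (hD z n).2
  have hsm (z : Set.Icc (0 : ℝ) 1) :
      Summable (fun n => L n (fun t => (t - (z : ℝ)) ^ 2) z * y ^ (n + 3)) :=
    Summable.of_nonneg_of_le (fun n => mul_nonneg (hD z n).1 (by positivity)) (hle z)
      hgeo.summable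
  have hbdd : BddAbove (Set.range fun z : Set.Icc (0 : ℝ) 1 =>
      ∑' n : ℕ, L n (fun t => (t - (z : ℝ)) ^ 2) z * y ^ (n + 3)) := by
    refine ⟨y ^ 3 * (1 - y)⁻¹, ?_⟩
    rintro _ ⟨z, rfl⟩
    exact (hgeo.tsum_eq).symm ▸ (hsm z).tsum_le_tsum (hle z) hgeo.summable
  have hT := mul_le_mul_of_nonneg_left (le_ciSup hbdd x) hy1'.le
  rw [← hδy] at hT
  have hω := modulus_nonneg f δ
  have hsum := ((hgeo.add ((hsm x).hasSum.div_const (δ ^ 2))).mul_left (modulus f δ))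
  have hterm (n : ℕ) : ‖(L n f x - f x) * y ^ (n + 3)‖ ≤ modulus f δ *
      (y ^ (n + 3) + L n (fun t => (t - (x : ℝ)) ^ 2) x * y ^ (n + 3) / δ ^ 2) := by
    have hyn := pow_pos hy0 (n + 3)
    rw [Real.norm_eq_abs, abs_mul, abs_of_pos hyn]
    refine (mul_le_mul_of_nonneg_right ((hL n x x.2).abs_sub_le hf hδ x.2) hyn.le).trans
      (le_of_eq ?_)
    ring
  have hmain := tsum_of_norm_bounded hsum hterm
  rw [Real.norm_eq_abs] at hmain
  refine (mul_le_mul_of_nonneg_left hmain hy1'.le).trans ?_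
  have hy3 : y ^ 3 ≤ 1 := pow_le_one₀ hy0.le hy1.le
  have h2 := (div_le_one (pow_pos hδ 2)).2 hT
  calc _ = modulus f δ * (y ^ 3 + (1 - y) * (∑' n : ℕ,
        L n (fun t => (t - (x : ℝ)) ^ 2) x * y ^ (n + 3)) / δ ^ 2) := by
        field_simp
    _ ≤ modulus f δ * (1 + 1) := by gcongr
    _ = _ := by ring

theorem stmt15 (q : ℕ → ℝ) (hq : ∀ n : ℕ, 1 ≤ n → 0 < q n ∧ q n < 1)
    (hsum : ∀ y ∈ Set.Ioo (0 : ℝ) 1,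
      Summable (fun n : ℕ =>
        (⨆ x : Set.Icc (0 : ℝ) 1, Durr (q (n + 3)) (n + 3) (fun t => (t - (x : ℝ)) ^ 2) x) *
          y ^ (n + 3)))
    (hφ : ∀ y ∈ Set.Ioo (0 : ℝ) 1, 0 < phiD q y)
    (μ : ℝ → ℝ) (hμ : ∀ y ∈ Set.Ioo (0 : ℝ) 1, 0 < μ y)
    (f : ℝ → ℝ) (hf : ContinuousOn f (Set.Icc 0 1))
    (hrate : Tendsto (fun y : ℝ => modulus f (phiD q y) / μ y) (𝓝[<] 1) (𝓝 0)) :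
    Tendsto (fun y : ℝ =>
        ((1 - y) * ⨆ x : Set.Icc (0 : ℝ) 1,
          |∑' n : ℕ, (Durr (q (n + 3)) (n + 3) f x - f x) * y ^ (n + 3)|) / μ y)
      (𝓝[<] 1) (𝓝 0) := by
  have hev : ∀ᶠ y : ℝ in 𝓝[<] 1, y ∈ Set.Ioo (0 : ℝ) 1 := Ioo_mem_nhdsLT zero_lt_one
  have h2 : Tendsto (fun y : ℝ => 2 * (modulus f (phiD q y) / μ y)) (𝓝[<] 1) (𝓝 0) := by
    simpa using hrate.const_mul 2
  refine squeeze_zero' ?_ ?_ h2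
  · filter_upwards [hev] with y hy
    exact div_nonneg (mul_nonneg (sub_nonneg.2 hy.2.le)
      (Real.iSup_nonneg fun _ => abs_nonneg _)) (hμ y hy).le
  · filter_upwards [hev] with y hy
    have hy1 : 0 < 1 - y := sub_pos.2 hy.2
    have hpos := hφ y hy
    have hsq : phiD q y ^ 2 = (1 - y) * ⨆ x : Set.Icc (0 : ℝ) 1, ∑' n : ℕ,
        Durr (q (n + 3)) (n + 3) (fun t => (t - (x : ℝ)) ^ 2) x * y ^ (n + 3) :=
      Real.sq_sqrt (Real.sqrt_pos.1 hpos).le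
    have key := abel_abs_tsum_le (L := fun n => Durr (q (n + 3)) (n + 3))
      (fun n x hx => isMean_Durr (hq (n + 3) (by omega)).1 (hq (n + 3) (by omega)).2 (n + 2) hx)
      (BddOnUnit.of_continuousOn hf) hy hpos hsq
    rw [← mul_div_assoc, Real.mul_iSup_of_nonneg hy1.le]
    refine div_le_div_of_nonneg_right ?_ (hμ y hy).le
    exact ciSup_le key
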